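/- Let $N \geq 2$ and $k \geq 0$ be integers, and consider tuples $(a_1, \dots, a_{N-1})$ of nonnegative integers with $\sum_i a_i \leq k$. The number of such tuples fixed by the involution $(a_1, \dots, a_{N-1}) \mapsto (a_{N-2}, a_{N-3}, \dots, a_1, k - \sum_i a_i)$ is: if $N$ is even, $\binom{k/2 + N/2 - 1}{N/2 - 1}$ when $k$ is even and $0$ when $k$ is odd; if $N$ is odd, $\binom{k/2 + (N-1)/2}{(N-1)/2}$ when $k$ is even and $\binom{(k-1)/2 + (N-1)/2}{(N-1)/2}$ when $k$ is odd. -/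

import Mathlib

theorem aux_count (r s : ℕ) :
    Set.ncard {x : Fin (r + 1) → ℕ | ∑ i, x i = s} = (s + r).choose r := by
  rw [← Nat.card_coe_set_eq]
  have e := Nat.card_congr (Sym.equivNatSumOfFintype (Fin (r + 1)) s)
  change Nat.card {x : Fin (r + 1) → ℕ // ∑ i, x i = s} = _
  rw [← e, Nat.card_eq_fintype_card, Sym.card_sym_eq_choose, Fintype.card_fin]
  rw [show r + 1 + s - 1 = s + r by omega]
  exact Nat.choose_symm_add

theorem aux_range (m : ℕ) (F : ℕ → ℕ) (e : ℕ) (h : ∀ p < m, F (m + e + p) = F (m - 1 - p)) :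
    ∑ p ∈ Finset.range m, F (m + e + p) = ∑ p ∈ Finset.range m, F p := by
  rw [← Finset.sum_range_reflect F m]
  exact Finset.sum_congr rfl fun p hp => h p (Finset.mem_range.1 hp)

theorem aux_sum_even (m : ℕ) (a : Fin (2 * m + 1) → ℕ)
    (h : ∀ p : ℕ, ∀ _hp : p < 2 * m, a ⟨p, by omega⟩ = a ⟨2 * m - 1 - p, by omega⟩) :
    ∑ i, a i = 2 * ∑ i : Fin m, a ⟨i, by omega⟩ + a ⟨2 * m, by omega⟩ := by
  let F : ℕ → ℕ := fun p => if hp : p < 2 * m + 1 then a ⟨p, hp⟩ else 0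
  have hF : ∀ p (hp : p < 2 * m + 1), F p = a ⟨p, hp⟩ := fun p hp => dif_pos hp
  have e1 : ∑ i, a i = ∑ p ∈ Finset.range (2 * m + 1), F p := by
    rw [Finset.sum_range]; exact Finset.sum_congr rfl fun i _ => (hF i i.2).symm
  have e2 : ∑ i : Fin m, a ⟨i, by omega⟩ = ∑ p ∈ Finset.range m, F p := by
    rw [Finset.sum_range]; exact Finset.sum_congr rfl fun i _ => (hF i (by omega)).symm
  have e3 := aux_range m F 0 (by
    intro p hp
    rw [hF _ (by omega), hF _ (by omega), h _ (by omega)]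
    congr 2; omega)
  have e4 : ∑ p ∈ Finset.range (2 * m), F p
      = ∑ p ∈ Finset.range m, F p + ∑ p ∈ Finset.range m, F (m + p) := by
    rw [two_mul, Finset.sum_range_add]
  rw [e1, e2, Finset.sum_range_succ, hF _ (by omega), e4]
  simp only [add_zero] at e3
  omega

theorem aux_sum_odd (m : ℕ) (a : Fin (2 * m + 2) → ℕ)
    (h : ∀ p : ℕ, ∀ _hp : p < 2 * m + 1, a ⟨p, by omega⟩ = a ⟨2 * m - p, by omega⟩) :
    ∑ i, a i = 2 * ∑ i : Fin m, a ⟨i, by omega⟩ + a ⟨m, by omega⟩ + a ⟨2 * m + 1, by omega⟩ := by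
  let F : ℕ → ℕ := fun p => if hp : p < 2 * m + 2 then a ⟨p, hp⟩ else 0
  have hF : ∀ p (hp : p < 2 * m + 2), F p = a ⟨p, hp⟩ := fun p hp => dif_pos hp
  have e1 : ∑ i, a i = ∑ p ∈ Finset.range (2 * m + 2), F p := by
    rw [Finset.sum_range]; exact Finset.sum_congr rfl fun i _ => (hF i i.2).symm
  have e2 : ∑ i : Fin m, a ⟨i, by omega⟩ = ∑ p ∈ Finset.range m, F p := by
    rw [Finset.sum_range]; exact Finset.sum_congr rfl fun i _ => (hF i (by omega)).symm
  have e3 := aux_range m F 1 (by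
    intro p hp
    rw [hF _ (by omega), hF _ (by omega), h _ (by omega)]
    congr 2; omega)
  have e4 : ∑ p ∈ Finset.range (2 * m + 1), F p
      = ∑ p ∈ Finset.range m, F p + F m + ∑ p ∈ Finset.range m, F (m + 1 + p) := by
    rw [show 2 * m + 1 = (m + 1) + m by omega, Finset.sum_range_add, Finset.sum_range_succ]
  rw [e1, e2, Finset.sum_range_succ, hF _ (by omega), e4, hF m (by omega)]
  omega

theorem aux_even (m k : ℕ) :
    Set.ncard {a : Fin (2 * m + 1) → ℕ |
        (∑ i, a i) ≤ k ∧
        (∀ p : ℕ, ∀ _hp : p < 2 * m,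
          a ⟨p, by omega⟩ = a ⟨2 * m - 1 - p, by omega⟩) ∧
        a ⟨2 * m, by omega⟩ = k - ∑ i, a i} =
      if Even k then (k / 2 + m).choose m else 0 := by
  split_ifs with hk
  · rw [← aux_count m (k / 2)]
    have hk' : 2 * (k / 2) = k := Nat.two_mul_div_two_of_even hk
    refine Set.ncard_congr (fun a _ i => if h : i.1 < m then a ⟨i, by omega⟩ else a ⟨2 * m, by omega⟩)
      ?_ ?_ ?_
    · rintro a ⟨h1, h2, h3⟩
      have := aux_sum_even m a h2
      simp only [Set.mem_ofPred_eq, Fin.sum_univ_castSucc]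
      simp
      omega
    · rintro a b ⟨-, ha, -⟩ ⟨-, hb, -⟩ hab
      have hlt : ∀ p (hp : p < m), a ⟨p, by omega⟩ = b ⟨p, by omega⟩ := by
        intro p hp
        have := congrFun hab ⟨p, by omega⟩
        simpa [hp] using this
      funext ⟨i, hi⟩
      rcases lt_trichotomy i (2 * m) with h | h | h
      · by_cases h' : i < m
        · exact hlt i h'
        · rw [ha i h, hb i h]; exact hlt _ (by omega)
      · subst h
        have := congrFun hab ⟨m, by omega⟩
        simpa using this
      · omega
    · intro x hx
      simp only [Set.mem_ofPred_eq, Fin.sum_univ_castSucc] at hx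
      let a : Fin (2 * m + 1) → ℕ := fun p =>
        if h : p.1 < m then x ⟨p, by omega⟩
        else if h : p.1 < 2 * m then x ⟨2 * m - 1 - p, by omega⟩ else x (Fin.last m)
      have hlt : ∀ p (hp : p < m), a ⟨p, by omega⟩ = x ⟨p, by omega⟩ := by
        intro p hp; simp [a, hp]
      have hm : a ⟨2 * m, by omega⟩ = x (Fin.last m) := by
        have : ¬ 2 * m < m := by omega
        simp [a, this]
      have hp : ∀ p : ℕ, ∀ _hp : p < 2 * m, a ⟨p, by omega⟩ = a ⟨2 * m - 1 - p, by omega⟩ := by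
        intro p hp
        by_cases h : p < m
        · have h1 : ¬ 2 * m - 1 - p < m := by omega
          have h2 : 2 * m - 1 - p < 2 * m := by omega
          have h3 : 2 * m - 1 - (2 * m - 1 - p) = p := by omega
          simp only [a, h, h1, h2, h3, dite_true, dite_false]
        · have h1 : 2 * m - 1 - p < m := by omega
          simp only [a, h, h1, hp, dite_true, dite_false]
      have hs := aux_sum_even m a hp
      have hc : ∑ i : Fin m, a ⟨i, by omega⟩ = ∑ i : Fin m, x i.castSucc :=
        Finset.sum_congr rfl fun i _ => hlt i i.2
      refine ⟨a, ⟨by omega, hp, by omega⟩, ?_⟩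
      funext ⟨i, hi⟩
      by_cases h : i < m
      · simp [h, hlt]
      · have : i = m := by omega
        subst this
        simp [hm, Fin.last]
  · refine Eq.trans (congrArg Set.ncard ?_) (Set.ncard_empty (Fin (2 * m + 1) → ℕ))
    rw [Set.eq_empty_iff_forall_notMem]
    rintro a ⟨h1, h2, h3⟩
    have := aux_sum_even m a h2
    apply hk
    exact ⟨∑ i : Fin m, a ⟨i, by omega⟩ + a ⟨2 * m, by omega⟩, by omega⟩

theorem aux_odd (m k : ℕ) :
    Set.ncard {a : Fin (2 * m + 2) → ℕ |
        (∑ i, a i) ≤ k ∧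
        (∀ p : ℕ, ∀ _hp : p < 2 * m + 1,
          a ⟨p, by omega⟩ = a ⟨2 * m - p, by omega⟩) ∧
        a ⟨2 * m + 1, by omega⟩ = k - ∑ i, a i} =
      (k / 2 + (m + 1)).choose (m + 1) := by
  rw [← aux_count (m + 1) (k / 2)]
  refine Set.ncard_congr (fun a _ i => if h : i.1 < m then a ⟨i, by omega⟩ else
    if i.1 = m then a ⟨m, by omega⟩ / 2 else a ⟨2 * m + 1, by omega⟩) ?_ ?_ ?_
  · rintro a ⟨h1, h2, h3⟩
    have := aux_sum_odd m a h2
    simp only [Set.mem_ofPred_eq, Fin.sum_univ_castSucc]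
    simp
    omega
  · rintro a b ⟨a1, ha, a3⟩ ⟨b1, hb, b3⟩ hab
    have hlt : ∀ p (hp : p < m), a ⟨p, by omega⟩ = b ⟨p, by omega⟩ := by
      intro p hp
      have := congrFun hab ⟨p, by omega⟩
      simpa [hp] using this
    have hl : a ⟨2 * m + 1, by omega⟩ = b ⟨2 * m + 1, by omega⟩ := by
      have := congrFun hab ⟨m + 1, by omega⟩
      simpa using this
    have hm : a ⟨m, by omega⟩ = b ⟨m, by omega⟩ := by
      have h0 := congrFun hab ⟨m, by omega⟩
      simp at h0
      have h1 := aux_sum_odd m a ha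
      have h2 := aux_sum_odd m b hb
      omega
    funext ⟨i, hi⟩
    by_cases h : i < 2 * m + 1
    · rcases lt_trichotomy i m with h' | h' | h'
      · exact hlt i h'
      · subst h'; exact hm
      · rw [ha i h, hb i h]; exact hlt _ (by omega)
    · have : i = 2 * m + 1 := by omega
      subst this
      exact hl
  · intro x hx
    simp only [Set.mem_ofPred_eq, Fin.sum_univ_castSucc] at hx
    let a : Fin (2 * m + 2) → ℕ := fun p =>
      if h : p.1 < m then x ⟨p, by omega⟩
      else if p.1 = m then 2 * x ⟨m, by omega⟩ + k % 2
      else if h : p.1 < 2 * m + 1 then x ⟨2 * m - p, by omega⟩ else x (Fin.last (m + 1))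
    have hlt : ∀ p (hp : p < m), a ⟨p, by omega⟩ = x ⟨p, by omega⟩ := by
      intro p hp; simp [a, hp]
    have hm : a ⟨m, by omega⟩ = 2 * x (Fin.last m).castSucc + k % 2 := by
      simp [a]; rfl
    have hl : a ⟨2 * m + 1, by omega⟩ = x (Fin.last (m + 1)) := by
      have h1 : ¬ 2 * m + 1 < m := by omega
      have h2 : ¬ 2 * m + 1 = m := by omega
      simp [a, h1, h2]
    have hp : ∀ p : ℕ, ∀ _hp : p < 2 * m + 1, a ⟨p, by omega⟩ = a ⟨2 * m - p, by omega⟩ := by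
      intro p hp
      rcases lt_trichotomy p m with h | h | h
      · have h1 : ¬ 2 * m - p < m := by omega
        have h1' : ¬ 2 * m - p = m := by omega
        have h2 : 2 * m - p < 2 * m + 1 := by omega
        have h3 : 2 * m - (2 * m - p) = p := by omega
        simp only [a, h, h1, h1', h2, h3, dite_true, dite_false, if_false]
      · congr 2; omega
      · have h1 : 2 * m - p < m := by omega
        have h2 : ¬ p < m := by omega
        have h3 : ¬ p = m := by omega
        simp only [a, h1, h2, h3, hp, dite_true, dite_false, if_false]
    have hs := aux_sum_odd m a hp
    have hc : ∑ i : Fin m, a ⟨i, by omega⟩ = ∑ i : Fin m, x i.castSucc.castSucc :=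
      Finset.sum_congr rfl fun i _ => hlt i i.2
    refine ⟨a, ⟨by omega, hp, by omega⟩, ?_⟩
    funext ⟨i, hi⟩
    rcases lt_trichotomy i m with h | h | h
    · simp [h, hlt]
    · subst h
      have : (2 * x (Fin.last i).castSucc + k % 2) / 2 = x (Fin.last i).castSucc := by omega
      simp only [lt_irrefl, dite_false, if_true, hm, this]
      rfl
    · have : i = m + 1 := by omega
      subst this
      simp [hl, Fin.last]


/-- The number of tuples `(a_1, …, a_{N-1})` of nonnegative integers with `∑ a_i ≤ k` that
are fixed by the involution `(a_1, …, a_{N-1}) ↦ (a_{N-2}, a_{N-3}, …, a_1, k - ∑ a_i)`.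
Indices are zero-based: position `p` (for `p < N - 2`) corresponds to `a_{p+1}` and must
equal the entry at position `N - 3 - p`, while the last position `N - 2` must equal
`k - ∑ a_i`. -/
theorem oldform_involution_fixed_point_count (N k : ℕ) (hN : 2 ≤ N) :
    Set.ncard {a : Fin (N - 1) → ℕ |
        (∑ i, a i) ≤ k ∧
        (∀ p : ℕ, ∀ _hp : p < N - 2,
          a ⟨p, by omega⟩ = a ⟨N - 3 - p, by omega⟩) ∧
        a ⟨N - 2, by omega⟩ = k - ∑ i, a i} =
      (if Even N then
        (if Even k then (k / 2 + N / 2 - 1).choose (N / 2 - 1) else 0)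
      else
        (if Even k then (k / 2 + (N - 1) / 2).choose ((N - 1) / 2)
         else ((k - 1) / 2 + (N - 1) / 2).choose ((N - 1) / 2))) := by
  rcases Nat.even_or_odd' N with ⟨n, rfl | rfl⟩
  · obtain ⟨m, rfl⟩ : ∃ m, n = m + 1 := ⟨n - 1, by omega⟩
    rw [if_pos (even_two_mul _)]
    have h1 : 2 * (m + 1) / 2 - 1 = m := by omega
    have h2 : k / 2 + 2 * (m + 1) / 2 - 1 = k / 2 + m := by omega
    rw [h1, h2]
    exact aux_even m k
  · obtain ⟨m, rfl⟩ : ∃ m, n = m + 1 := ⟨n - 1, by omega⟩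
    rw [if_neg (by simp)]
    have h1 : (2 * (m + 1) + 1 - 1) / 2 = m + 1 := by omega
    have h2 : (if Even k then (k / 2 + (m + 1)).choose (m + 1)
        else ((k - 1) / 2 + (m + 1)).choose (m + 1)) = (k / 2 + (m + 1)).choose (m + 1) := by
      split_ifs with hk
      · rfl
      · have : (k - 1) / 2 = k / 2 := by
          have := Nat.not_even_iff.1 hk
          omega
        rw [this]
    rw [h1, h2]
    exact aux_odd m k
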